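/- (Multivariate sign-kernel representation on ℝ^d) Let f : ℝ^d → ℝ be d-times continuously differentiable such that for every subset J ⊆ {1,…,d} the mixed partial ∂^{|J|}f/∏_{k∈J}∂z_k is bounded at infinity, and such that all relevant integrals converge absolutely. Then for every x ∈ ℝ^d and a > 0: f(x) = ∫_{ℝ^d} (2a)^{−d} [ Σ_{J⊆{1,…,d}} a^{|J|} (∂^{|J|}f/∏_{k∈J}∂z_k)(z) ∏_{k∈J} sign(x_k−z_k) ] exp(−‖x−z‖₁/a) dz + C, where C is a constant independent of x. -/

import Mathlib

open MeasureTheory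

/-- The mixed partial derivative of `f` with respect to the (distinct) coordinates
in the finite set `J`. -/
noncomputable def mixedPartial {d : ℕ} (f : (Fin d → ℝ) → ℝ) (J : Finset (Fin d))
    (z : Fin d → ℝ) : ℝ :=
  iteratedFDeriv ℝ J.card f z
    (fun i : Fin J.card => Pi.single ((J.orderIsoOfFin rfl i : Fin d)) 1)

open Filter Topology

theorem sk_meas_sign : Measurable Real.sign := by
  have : Real.sign = fun r : ℝ => if r < 0 then (-1:ℝ) else if 0 < r then 1 else 0 := by
    ext r; rfl
  rw [this]
  exact Measurable.ite measurableSet_Iio measurable_const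
    (Measurable.ite measurableSet_Ioi measurable_const measurable_const)

theorem sk_abs_sign (r : ℝ) : |Real.sign r| ≤ 1 := by
  rcases Real.sign_apply_eq r with h | h | h <;> simp [h]

theorem sk_left (a : ℝ) (ha : 0 < a) (x : ℝ) :
    IntegrableOn (fun t => Real.exp ((t - x) / a)) (Set.Iic x) := by
  have := (integrableOn_exp_mul_Iic (a := 1 / a) (by positivity) x).const_mul (Real.exp (-x / a))
  refine this.congr (Eventually.of_forall fun t => ?_)
  simp only [← Real.exp_add]; congr 1; ring

theorem sk_right (a : ℝ) (ha : 0 < a) (x : ℝ) :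
    IntegrableOn (fun t => Real.exp (-(t - x) / a)) (Set.Ioi x) := by
  have := (integrableOn_exp_mul_Ioi (a := -(1 / a)) (by simpa using ha) x).const_mul
    (Real.exp (x / a))
  refine this.congr (Eventually.of_forall fun t => ?_)
  simp only [← Real.exp_add]; congr 1; ring

theorem sk_int_exp (a : ℝ) (ha : 0 < a) (x : ℝ) :
    Integrable (fun t => Real.exp (-|x - t| / a)) := by
  rw [← integrableOn_univ, ← Set.Iic_union_Ioi (a := x)]
  refine IntegrableOn.union ?_ ?_
  · refine (sk_left a ha x).congr_fun (fun t ht => ?_) measurableSet_Iic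
    have : t ≤ x := ht
    simp only [abs_of_nonneg (sub_nonneg.2 this)]; congr 1; ring
  · refine (sk_right a ha x).congr_fun (fun t ht => ?_) measurableSet_Ioi
    have : x < t := ht
    simp only [abs_of_nonpos (sub_nonpos.2 this.le)]; congr 1; ring

theorem sk_one (a : ℝ) (ha : 0 < a) (x : ℝ) (g g' : ℝ → ℝ) (hc : Continuous g')
    (hg : ∀ t, HasDerivAt g (g' t) t) (M M' : ℝ) (hM : ∀ t, |g t| ≤ M) (hM' : ∀ t, |g' t| ≤ M') :
    ∫ t, (g t + a * g' t * Real.sign (x - t)) * (Real.exp (-|x - t| / a) / (2 * a)) = g x := by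
  have hgc : Continuous g := continuous_iff_continuousAt.2 fun t => (hg t).continuousAt
  have e1 : ∀ t ∈ Set.Iio x,
      (g t + a * g' t * Real.sign (x - t)) * (Real.exp (-|x - t| / a) / (2 * a))
      = (1/2) * (g' t * Real.exp ((t - x)/a) + g t * (Real.exp ((t - x)/a) * (1 / a))) := by
    intro t ht
    have h : 0 < x - t := sub_pos.2 ht
    rw [Real.sign_of_pos h, abs_of_pos h, show -(x - t) / a = (t - x) / a by ring]
    field_simp
    ring
  have e2 : ∀ t ∈ Set.Ioi x,
      (g t + a * g' t * Real.sign (x - t)) * (Real.exp (-|x - t| / a) / (2 * a))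
      = (-1/2) * (g' t * Real.exp (-(t - x)/a) + g t * (Real.exp (-(t - x)/a) * (-1 / a))) := by
    intro t ht
    have h : x - t < 0 := sub_neg.2 ht
    rw [Real.sign_of_neg h, abs_of_neg h, show -(-(x - t)) / a = -(t - x) / a by ring]
    field_simp
    ring
  have key : ∀ c : ℝ, ∀ s : Set ℝ, ∀ E : ℝ → ℝ, IntegrableOn E s → IntegrableOn (fun t =>
      g' t * E t + g t * (E t * c)) s := by
    intro c s E hE
    refine Integrable.add ?_ ?_
    · exact Integrable.bdd_mul (c := M') hE hc.aestronglyMeasurable (Eventually.of_forall hM')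
    · exact Integrable.bdd_mul (c := M) (hE.mul_const c) hgc.aestronglyMeasurable
        (Eventually.of_forall hM)
  have tend : ∀ l : Filter ℝ, ∀ E : ℝ → ℝ, Tendsto E l (𝓝 0) →
      Tendsto (fun t => g t * E t) l (𝓝 0) := by
    intro l E hE
    refine squeeze_zero_norm (a := fun t => M * |E t|) (fun t => ?_) ?_
    · rw [norm_mul]; exact mul_le_mul_of_nonneg_right (hM t) (abs_nonneg _)
    · simpa using hE.abs.const_mul M
  have i1 := key (1 / a) _ _ (sk_left a ha x)
  have i2 := key (-1 / a) _ _ (sk_right a ha x)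
  have t1 : ∫ t in Set.Iic x,
      (g' t * Real.exp ((t - x)/a) + g t * (Real.exp ((t - x)/a) * (1 / a))) = g x := by
    rw [integral_Iic_of_hasDerivAt_of_tendsto' (f := fun t => g t * Real.exp ((t - x) / a))
      (m := 0) ?_ i1 ?_]
    · simp
    · intro t _
      exact (hg t).mul ((((hasDerivAt_id t).sub_const x).div_const a).exp)
    · refine tend _ _ (Real.tendsto_exp_atBot.comp ?_)
      exact (tendsto_atBot_add_const_right _ (-x) tendsto_id).atBot_div_const ha
  have t2 : ∫ t in Set.Ioi x,
      (g' t * Real.exp (-(t - x)/a) + g t * (Real.exp (-(t - x)/a) * (-1 / a))) = - g x := by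
    rw [integral_Ioi_of_hasDerivAt_of_tendsto' (f := fun t => g t * Real.exp (-(t - x) / a))
      (m := 0) ?_ i2 ?_]
    · simp
    · intro t _
      exact (hg t).mul ((((hasDerivAt_id t).sub_const x).neg.div_const a).exp)
    · refine tend _ _ (Real.tendsto_exp_atBot.comp ?_)
      exact (tendsto_neg_atTop_atBot.comp
        (tendsto_atTop_add_const_right _ (-x) tendsto_id)).atBot_div_const ha
  have j1 : IntegrableOn (fun t => (g t + a * g' t * Real.sign (x - t)) *
      (Real.exp (-|x - t| / a) / (2 * a))) (Set.Iio x) :=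
    (IntegrableOn.congr_fun ((i1.mono_set Set.Iio_subset_Iic_self).const_mul (1/2))
      (fun t ht => (e1 t ht).symm) measurableSet_Iio)
  have j2 : IntegrableOn (fun t => (g t + a * g' t * Real.sign (x - t)) *
      (Real.exp (-|x - t| / a) / (2 * a))) (Set.Ioi x) :=
    IntegrableOn.congr_fun (i2.const_mul (-1/2))
      (fun t ht => (e2 t ht).symm) measurableSet_Ioi
  rw [← intervalIntegral.integral_Iic_add_Ioi (b := x) ((integrableOn_Iic_iff_integrableOn_Iio enorm_ne_top).2 j1) j2,
    integral_Iic_eq_integral_Iio, setIntegral_congr_fun measurableSet_Iio e1,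
    setIntegral_congr_fun measurableSet_Ioi e2, integral_const_mul, integral_const_mul,
    ← integral_Iic_eq_integral_Iio, t1, t2]
  ring

theorem sk_sum_split (d : ℕ) (F : Finset (Fin (d + 1)) → ℝ) :
    ∑ J, F J = ∑ J : Finset (Fin d), (F (J.map (Fin.succEmb d)) +
      F (insert 0 (J.map (Fin.succEmb d)))) := by
  classical
  have h0 : (0 : Fin (d+1)) ∉ (Finset.univ : Finset (Fin d)).map (Fin.succEmb d) := by
    simp 
  have hu : (Finset.univ : Finset (Fin (d+1))) =
      insert 0 ((Finset.univ : Finset (Fin d)).map (Fin.succEmb d)) := by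
    ext k; refine Fin.cases ?_ (fun i => ?_) k <;> simp
  have hp : ((Finset.univ : Finset (Fin d)).map (Fin.succEmb d)).powerset =
      (Finset.univ : Finset (Finset (Fin d))).map
        ⟨fun J => J.map (Fin.succEmb d), Finset.map_injective _⟩ := by
    ext J
    simp only [Finset.mem_powerset, Finset.mem_map, Finset.mem_univ, true_and,
      Function.Embedding.coeFn_mk]
    rw [Finset.subset_map_iff]
    simp [eq_comm]
  rw [← Finset.powerset_univ, hu, Finset.sum_powerset_insert h0, hp, Finset.sum_map,
    Finset.sum_map, ← Finset.sum_add_distrib]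
  rfl

/-- The integrand. -/
noncomputable def skI (d : ℕ) (a : ℝ) (g : Finset (Fin d) → (Fin d → ℝ) → ℝ)
    (x z : Fin d → ℝ) : ℝ :=
  (∑ J : Finset (Fin d), a ^ J.card * g J z * ∏ k ∈ J, Real.sign (x k - z k)) *
    ∏ k, (Real.exp (-|x k - z k| / a) / (2 * a))

theorem skI_integrable (d : ℕ) (a : ℝ) (ha : 0 < a) (g : Finset (Fin d) → (Fin d → ℝ) → ℝ)
    (hc : ∀ J, Continuous (g J)) (hb : ∀ J, ∃ M : ℝ, ∀ z, |g J z| ≤ M) (x : Fin d → ℝ) :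
    Integrable (skI d a g x) := by
  unfold skI
  simp only [Finset.sum_mul]
  refine integrable_finsetSum _ fun J _ => ?_
  obtain ⟨M, hM⟩ := hb J
  refine Integrable.bdd_mul (c := |a ^ J.card| * M) ?_ ?_ (Eventually.of_forall fun z => ?_)
  · exact Integrable.fintype_prod (μ := fun _ => volume)
      (f := fun k t => Real.exp (-|x k - t| / a) / (2 * a))
      fun k => (sk_int_exp a ha (x k)).div_const _
  · refine Measurable.aestronglyMeasurable ?_
    refine (measurable_const.mul (hc J).measurable).mul ?_
    refine Finset.measurable_prod _ fun k _ => ?_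
    exact sk_meas_sign.comp (measurable_const.sub (measurable_pi_apply k))
  · rw [norm_mul, norm_mul, norm_prod]
    have h1 : ∏ k ∈ J, ‖Real.sign (x k - z k)‖ ≤ 1 :=
      Finset.prod_le_one (fun _ _ => norm_nonneg _) fun k _ => sk_abs_sign _
    have h2 : ‖a ^ J.card‖ * ‖g J z‖ ≤ |a ^ J.card| * M :=
      mul_le_mul_of_nonneg_left (hM z) (abs_nonneg _)
    calc _ ≤ ‖a ^ J.card‖ * ‖g J z‖ * 1 := mul_le_mul_of_nonneg_left h1 (by positivity)
      _ ≤ _ := by rw [mul_one]; exact h2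

theorem skI_cons (d : ℕ) (a : ℝ) (g : Finset (Fin (d+1)) → (Fin (d+1) → ℝ) → ℝ)
    (x : Fin (d+1) → ℝ) (t : ℝ) (y : Fin d → ℝ) :
    skI (d+1) a g x (Fin.cons t y) =
    ∑ J : Finset (Fin d), (a ^ J.card * (∏ k ∈ J, Real.sign (x k.succ - y k)) *
      ∏ k, (Real.exp (-|x (Fin.succ k) - y k| / a) / (2 * a))) *
      ((g (J.map (Fin.succEmb d)) (Fin.cons t y) +
        a * g (insert 0 (J.map (Fin.succEmb d))) (Fin.cons t y) * Real.sign (x 0 - t)) *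
       (Real.exp (-|x 0 - t| / a) / (2 * a))) := by
  unfold skI
  rw [sk_sum_split, Finset.sum_mul, Fin.prod_univ_succ]
  refine Finset.sum_congr rfl fun J _ => ?_
  have h0 : (0 : Fin (d+1)) ∉ J.map (Fin.succEmb d) := by simp
  rw [Finset.prod_insert h0, Finset.card_insert_of_notMem h0, Finset.card_map, Finset.prod_map]
  simp only [Fin.coe_succEmb, Fin.cons_succ, Fin.cons_zero]
  ring

theorem sk_main (d : ℕ) (a : ℝ) (ha : 0 < a) (g : Finset (Fin d) → (Fin d → ℝ) → ℝ)
    (hc : ∀ J, Continuous (g J)) (hb : ∀ J, ∃ M : ℝ, ∀ z, |g J z| ≤ M)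
    (hd : ∀ J k, (∀ j ∈ J, k < j) → ∀ z t, HasDerivAt (fun s => g J (Function.update z k s))
      (g (insert k J) (Function.update z k t)) t) (x : Fin d → ℝ) :
    ∫ z, skI d a g x z = g ∅ x := by
  induction d with
  | zero =>
    have hx : ∀ z : Fin 0 → ℝ, z = x := fun z => Subsingleton.elim _ _
    have : ∀ z, skI 0 a g x z = g ∅ x := by
      intro z
      rw [hx z]
      have hu : (Finset.univ : Finset (Finset (Fin 0))) = {∅} := rfl
      simp [skI, hu, -Finset.univ_unique]
    simp_rw [this]
    simp [integral_const, measureReal_def, volume_pi]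
  | succ d ih =>
    have hI := skI_integrable (d+1) a ha g hc hb x
    have hmp := (volume_preserving_piFinSuccAbove (fun _ : Fin (d+1) => ℝ) 0).symm
    have hE : ∀ p : ℝ × (Fin d → ℝ),
        (MeasurableEquiv.piFinSuccAbove (fun _ : Fin (d+1) => ℝ) 0).symm p
          = Fin.cons p.1 p.2 := by
      intro p
      simp [MeasurableEquiv.piFinSuccAbove]
      rfl
    have hI' : Integrable (fun p : ℝ × (Fin d → ℝ) => skI (d+1) a g x (Fin.cons p.1 p.2))
        (volume.prod volume) := by
      have := (hmp.integrable_comp_emb (MeasurableEquiv.measurableEmbedding _)).2 hI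
      simp only [Function.comp_def, hE] at this
      exact this
    rw [← hmp.integral_comp (MeasurableEquiv.measurableEmbedding _)]
    simp only [hE]
    rw [Measure.volume_eq_prod, integral_prod_symm _ hI']
    have hup : ∀ (y : Fin d → ℝ) (s : ℝ),
        (Fin.cons s y : Fin (d+1) → ℝ) = Function.update (Fin.cons (x 0) y) 0 s := by
      intro y s; simp
    have hcc : ∀ y : Fin d → ℝ, Continuous fun s : ℝ => (Fin.cons s y : Fin (d+1) → ℝ) := by
      intro y
      refine continuous_pi fun k => ?_
      refine Fin.cases ?_ (fun i => ?_) k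
      · simpa using! continuous_id
      · simpa using continuous_const
    have hcc' : Continuous fun y : Fin d → ℝ => (Fin.cons (x 0) y : Fin (d+1) → ℝ) := by
      refine continuous_pi fun k => ?_
      refine Fin.cases ?_ (fun i => ?_) k
      · simpa using continuous_const
      · simpa using continuous_apply i
    have inner : ∀ y : Fin d → ℝ, ∫ t, skI (d+1) a g x (Fin.cons t y) =
        skI d a (fun J y => g (J.map (Fin.succEmb d)) (Fin.cons (x 0) y)) (Fin.tail x) y := by
      intro y
      simp only [skI_cons]
      rw [integral_finsetSum]
      · unfold skI
        rw [Finset.sum_mul]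
        refine Finset.sum_congr rfl fun J _ => ?_
        obtain ⟨M, hM⟩ := hb (J.map (Fin.succEmb d))
        obtain ⟨M', hM'⟩ := hb (insert 0 (J.map (Fin.succEmb d)))
        rw [integral_const_mul, sk_one a ha (x 0)
          (fun t => g (J.map (Fin.succEmb d)) (Fin.cons t y))
          (fun t => g (insert 0 (J.map (Fin.succEmb d))) (Fin.cons t y))
          ((hc _).comp (hcc y)) ?_ M M' (fun _ => hM _) (fun _ => hM' _)]
        · simp only [Fin.tail]; ring
        · intro t
          have := hd (J.map (Fin.succEmb d)) 0 (by simp) (Fin.cons (x 0) y) t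
          simpa only [← hup y] using this
      · intro J _
        refine Integrable.const_mul ?_ _
        obtain ⟨M, hM⟩ := hb (J.map (Fin.succEmb d))
        obtain ⟨M', hM'⟩ := hb (insert 0 (J.map (Fin.succEmb d)))
        refine Integrable.bdd_mul (c := M + |a| * M') ((sk_int_exp a ha (x 0)).div_const _) ?_
          (Eventually.of_forall fun t => ?_)
        · refine Measurable.aestronglyMeasurable ?_
          refine ((hc _).comp (hcc y)).measurable.add ?_
          exact (measurable_const.mul ((hc _).comp (hcc y)).measurable).mul
            (sk_meas_sign.comp (measurable_const.sub measurable_id))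
        · refine (norm_add_le _ _).trans (add_le_add (hM _) ?_)
          rw [norm_mul, norm_mul]
          have h2 := hM' (Fin.cons t y)
          have h1 := sk_abs_sign (x 0 - t)
          calc _ ≤ ‖a‖ * ‖g (insert 0 (J.map (Fin.succEmb d))) (Fin.cons t y)‖ * 1 :=
                mul_le_mul_of_nonneg_left h1 (by positivity)
            _ ≤ _ := by rw [mul_one]; exact mul_le_mul_of_nonneg_left h2 (abs_nonneg _)
    simp only [inner]
    rw [ih]
    · simp only [Finset.map_empty]
      congr 1
      exact Fin.cons_self_tail x
    · exact fun J => (hc _).comp hcc'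
    · intro J
      obtain ⟨M, hM⟩ := hb (J.map (Fin.succEmb d))
      exact ⟨M, fun z => hM _⟩
    · intro J k hk z t
      have := hd (J.map (Fin.succEmb d)) k.succ (by simpa using hk) (Fin.cons (x 0) z) t
      simpa only [Fin.cons_update, Finset.map_insert, Fin.coe_succEmb] using this

theorem sk_mp_eq {d : ℕ} (f : (Fin d → ℝ) → ℝ) (J : Finset (Fin d))
    (z : Fin d → ℝ) (n : ℕ) (hn : n = J.card) (e : Fin n → Fin d) (hi : StrictMono e)
    (he : ∀ i, e i ∈ J) :
    mixedPartial f J z = iteratedFDeriv ℝ n f z (fun i => Pi.single (e i) 1) := by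
  subst hn
  rw [Finset.orderEmbOfFin_unique rfl he hi]
  rfl

theorem sk_mp_cont {d : ℕ} (f : (Fin d → ℝ) → ℝ) (hf : ContDiff ℝ d f) (J : Finset (Fin d)) :
    Continuous (mixedPartial f J) := by
  have hJ : J.card ≤ d := by simpa using J.card_le_univ
  have h := hf.continuous_iteratedFDeriv (m := J.card) (by exact_mod_cast hJ)
  exact (ContinuousMultilinearMap.apply ℝ (fun _ : Fin J.card => (Fin d → ℝ)) ℝ
    (fun i : Fin J.card => Pi.single ((J.orderIsoOfFin rfl i : Fin d)) 1)).continuous.comp h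

theorem sk_mp_deriv {d : ℕ} (f : (Fin d → ℝ) → ℝ) (hf : ContDiff ℝ d f) (J : Finset (Fin d))
    (k : Fin d) (hlt : ∀ j ∈ J, k < j) (z : Fin d → ℝ) (t : ℝ) :
    HasDerivAt (fun s => mixedPartial f J (Function.update z k s))
      (mixedPartial f (insert k J) (Function.update z k t)) t := by
  have hk : k ∉ J := fun h => lt_irrefl _ (hlt k h)
  have hJ : J.card < d := by
    have := (insert k J).card_le_univ
    rw [Finset.card_insert_of_notMem hk, Fintype.card_fin] at this
    exact this
  have hdf := hf.differentiable_iteratedFDeriv (m := J.card) (by exact_mod_cast hJ)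
  rw [sk_mp_eq f (insert k J) _ (J.card + 1) (Finset.card_insert_of_notMem hk).symm
    (Fin.cons k (fun i => (J.orderIsoOfFin rfl i : Fin d))) ?_ ?_]
  · rw [iteratedFDeriv_succ_apply_left]
    have h1 := (hdf (Function.update z k t)).hasFDerivAt.comp_hasDerivAt t
      (hasDerivAt_update z k t)
    have h2 := (ContinuousMultilinearMap.apply ℝ (fun _ : Fin J.card => (Fin d → ℝ)) ℝ
      (fun i : Fin J.card => Pi.single ((J.orderIsoOfFin rfl i : Fin d)) 1)).hasFDerivAt.comp_hasDerivAt t h1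
    exact h2
  · intro i j hij
    induction i using Fin.cases with
    | zero =>
      induction j using Fin.cases with
      | zero => exact absurd hij (lt_irrefl _)
      | succ j => exact hlt _ (J.orderIsoOfFin rfl j).2
    | succ i =>
      induction j using Fin.cases with
      | zero => exact absurd hij (by simp)
      | succ j =>
        exact (J.orderIsoOfFin rfl).strictMono (Fin.succ_lt_succ_iff.1 hij)
  · intro i
    refine Fin.cases ?_ (fun i => ?_) i
    · simp
    · simp only [Fin.cons_succ]
      exact Finset.mem_insert_of_mem (J.orderIsoOfFin rfl i).2

/-- Multivariate sign-kernel representation on ℝ^d: for a `d`-times continuously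
differentiable `f` with bounded mixed partials and absolutely convergent integrals,
`f(x) = ∫ (2a)^{-d} [Σ_J a^{|J|} ∂_J f(z) Π_{k∈J} sign(x_k - z_k)] e^{-‖x-z‖₁/a} dz + C`
for a constant `C` independent of `x`. -/
theorem multivariate_sign_kernel_representation
    (d : ℕ) (a : ℝ) (ha : 0 < a)
    (f : (Fin d → ℝ) → ℝ) (hf : ContDiff ℝ d f)
    (hbdd : ∀ J : Finset (Fin d), ∃ M : ℝ, ∀ z, |mixedPartial f J z| ≤ M)
    (hint : ∀ x : Fin d → ℝ, Integrable (fun z : Fin d → ℝ =>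
      (∑ J : Finset (Fin d), a ^ J.card * mixedPartial f J z *
          ∏ k ∈ J, Real.sign (x k - z k)) *
        Real.exp (-(∑ k, |x k - z k|) / a) / (2 * a) ^ d)) :
    ∃ C : ℝ, ∀ x : Fin d → ℝ,
      f x = (∫ z : Fin d → ℝ,
        (∑ J : Finset (Fin d), a ^ J.card * mixedPartial f J z *
            ∏ k ∈ J, Real.sign (x k - z k)) *
          Real.exp (-(∑ k, |x k - z k|) / a) / (2 * a) ^ d) + C := by
  refine ⟨0, fun x => ?_⟩
  have h := sk_main d a ha (mixedPartial f) (sk_mp_cont f hf) hbdd (sk_mp_deriv f hf) x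
  have h0 : mixedPartial f ∅ x = f x := by
    rw [sk_mp_eq f ∅ x 0 rfl Fin.elim0 (fun i => i.elim0) (fun i => i.elim0)]
    simp
  rw [add_zero, ← h0, ← h]
  congr 1
  ext z
  unfold skI
  rw [mul_div_assoc]
  congr 1
  rw [Finset.prod_div_distrib, ← Real.exp_sum, Finset.prod_const, Finset.card_univ,
    Fintype.card_fin, ← Finset.sum_div, Finset.sum_neg_distrib]
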